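/- Let n ≥ 1 and let P ⊆ [0,1]ⁿ be the range of some Z-retraction of [0,1]ⁿ, and suppose P is a closed domain. Let Q₁ = P, Q₂, …, Q_m ⊆ [0,1]ⁿ be pairwise disjoint rational polyhedra such that for each j there is a Z-homeomorphism of Q_j onto P. Then there exists a Z-retraction σ of [0,1]ⁿ with range P such that for every j = 1,…,m the restriction of σ to Q_j is a Z-homeomorphism of Q_j onto P; in particular σ has at least m Z-homeomorphism domains. -/

import Mathlib

open Set MeasureTheory

/-- The unit cube `[0,1]^n` in `ℝ^n`. -/
def cubeSet (n : ℕ) : Set (Fin n → ℝ) := Set.Icc 0 1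

/-- A point all of whose coordinates are rational. -/
def IsRationalPoint {n : ℕ} (v : Fin n → ℝ) : Prop := ∀ i, ∃ q : ℚ, v i = (q : ℝ)

/-- A rational polyhedron: a finite union of convex hulls of finite sets of rational points. -/
def IsRationalPolyhedron {n : ℕ} (P : Set (Fin n → ℝ)) : Prop :=
  ∃ S : Finset (Finset (Fin n → ℝ)),
    (∀ F ∈ S, ∀ v ∈ F, IsRationalPoint v) ∧
    P = ⋃ F ∈ S, convexHull ℝ (F : Set (Fin n → ℝ))

/-- An affine map `x ↦ Mx + b` with integer matrix `M` and integer vector `b`. -/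
def IsIntAffine {n m : ℕ} (g : (Fin n → ℝ) → (Fin m → ℝ)) : Prop :=
  ∃ (M : Fin m → Fin n → ℤ) (b : Fin m → ℤ),
    ∀ x i, g x i = (∑ j, (M i j : ℝ) * x j) + (b i : ℝ)

/-- A Z-map on `P`: continuous on `P`, with finitely many integer affine pieces. -/
def IsZMapOn {n m : ℕ} (P : Set (Fin n → ℝ)) (f : (Fin n → ℝ) → (Fin m → ℝ)) : Prop :=
  ContinuousOn f P ∧
  ∃ (k : ℕ) (g : Fin k → (Fin n → ℝ) → (Fin m → ℝ)),
    (∀ i, IsIntAffine (g i)) ∧ ∀ x ∈ P, ∃ i, f x = g i x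

/-- `f` restricted to `P` is a Z-homeomorphism of `P` onto `Q`. -/
def IsZHomeoOnto {n m : ℕ} (P : Set (Fin n → ℝ)) (Q : Set (Fin m → ℝ))
    (f : (Fin n → ℝ) → (Fin m → ℝ)) : Prop :=
  IsZMapOn P f ∧ f '' P = Q ∧ Set.InjOn f P ∧
  ∃ g : (Fin m → ℝ) → (Fin n → ℝ),
    IsZMapOn Q g ∧ (∀ x ∈ P, g (f x) = x) ∧ (∀ y ∈ Q, f (g y) = y)

/-- A Z-retraction of the cube `[0,1]^n`. -/
def IsZRetraction {n : ℕ} (σ : (Fin n → ℝ) → (Fin n → ℝ)) : Prop :=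
  IsZMapOn (cubeSet n) σ ∧ Set.MapsTo σ (cubeSet n) (cubeSet n) ∧
  ∀ x ∈ cubeSet n, σ (σ x) = σ x

/-- The range `R_σ = σ([0,1]^n)` of a Z-retraction. -/
def zRange {n : ℕ} (σ : (Fin n → ℝ) → (Fin n → ℝ)) : Set (Fin n → ℝ) := σ '' cubeSet n

/-- A Z-homeomorphism domain for `σ`: a rational polyhedron `Q ⊆ [0,1]^n` such that
`σ` restricted to `Q` is a Z-homeomorphism of `Q` onto `R_σ`. -/
def IsZHomeoDomain {n : ℕ} (σ : (Fin n → ℝ) → (Fin n → ℝ)) (Q : Set (Fin n → ℝ)) : Prop :=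
  IsRationalPolyhedron Q ∧ Q ⊆ cubeSet n ∧ IsZHomeoOnto Q (zRange σ) σ

/-- A (Kuratowski) closed domain: `D` equals the closure of its interior. -/
def IsClosedDomain {n : ℕ} (D : Set (Fin n → ℝ)) : Prop :=
  closure (interior D) = D

/-- A scalar integer affine map. -/
def IsIntAffine1 {n : ℕ} (g : (Fin n → ℝ) → ℝ) : Prop :=
  ∃ (m : Fin n → ℤ) (b : ℤ), ∀ x, g x = (∑ j, (m j : ℝ) * x j) + (b : ℝ)

/-- A scalar Z-map on `P`. -/
def IsZMapOn1 {n : ℕ} (P : Set (Fin n → ℝ)) (f : (Fin n → ℝ) → ℝ) : Prop :=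
  ContinuousOn f P ∧
  ∃ (k : ℕ) (g : Fin k → (Fin n → ℝ) → ℝ),
    (∀ i, IsIntAffine1 (g i)) ∧ ∀ x ∈ P, ∃ i, f x = g i x

/-- The free MV-algebra `McN([0,1]^n)`, viewed as a set of functions on the cube. -/
def McN (n : ℕ) : Set (↥(cubeSet n) → ℝ) :=
  { f | (∀ x, f x ∈ Set.Icc (0:ℝ) 1) ∧
    ∃ g : (Fin n → ℝ) → ℝ, IsZMapOn1 (cubeSet n) g ∧ ∀ x : ↥(cubeSet n), f x = g x.1 }

/-- Pointwise MV-sum `f ⊕ g = min(f + g, 1)`. -/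
def mvAdd {X : Type*} (f g : X → ℝ) : X → ℝ := fun x => min (f x + g x) 1

/-- Pointwise MV-negation `¬f = 1 - f`. -/
def mvNeg {X : Type*} (f : X → ℝ) : X → ℝ := fun x => 1 - f x

/-- The retract `A_σ = {g ∘ σ : g ∈ McN([0,1]^n)}` associated with a Z-retraction `σ`. -/
def retAlg {n : ℕ} (σ : (Fin n → ℝ) → (Fin n → ℝ)) : Set (↥(cubeSet n) → ℝ) :=
  { f | ∃ g ∈ McN n, ∀ (x : ↥(cubeSet n)) (h : σ x.1 ∈ cubeSet n), f x = g ⟨σ x.1, h⟩ }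

/-- `ε` is a retraction of `McN([0,1]^n)` onto `A`. -/
def IsMcNRetraction {n : ℕ} (ε : ↥(McN n) → ↥(McN n)) (A : Set (↥(cubeSet n) → ℝ)) : Prop :=
  (∀ (f g : ↥(McN n)) (h : mvAdd f.1 g.1 ∈ McN n),
      (ε ⟨mvAdd f.1 g.1, h⟩).1 = mvAdd (ε f).1 (ε g).1) ∧
  (∀ (f : ↥(McN n)) (h : mvNeg f.1 ∈ McN n),
      (ε ⟨mvNeg f.1, h⟩).1 = mvNeg (ε f).1) ∧
  (∀ f, ε (ε f) = ε f) ∧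
  Subtype.val '' Set.range ε = A

/-- An MV-isomorphism between two sets of `[0,1]`-valued functions. -/
def IsMVIsoFun {X Y : Type*} (A : Set (X → ℝ)) (B : Set (Y → ℝ)) (h : ↥A → ↥B) : Prop :=
  Function.Bijective h ∧
  (∀ (f g : ↥A) (hm : mvAdd f.1 g.1 ∈ A),
      (h ⟨mvAdd f.1 g.1, hm⟩).1 = mvAdd (h f).1 (h g).1) ∧
  (∀ (f : ↥A) (hm : mvNeg f.1 ∈ A),
      (h ⟨mvNeg f.1, hm⟩).1 = mvNeg (h f).1)

/-- **Farkas' lemma** over a linearly ordered field, in the form of a statement about linear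
functionals on an arbitrary vector space. -/
theorem exists_nonneg_combination_of_forall_nonpos {K W ι : Type*} [Field K] [LinearOrder K]
    [IsStrictOrderedRing K] [AddCommGroup W] [Module K W] (s : Finset ι) :
    ∀ (a : ι → W →ₗ[K] K) (γ : W →ₗ[K] K), (∀ x, (∀ i ∈ s, a i x ≤ 0) → γ x ≤ 0) →
      ∃ c : ι → K, (∀ i, 0 ≤ c i) ∧ γ = ∑ i ∈ s, c i • a i := by
  classical
  induction s using Finset.induction_on with
  | empty =>
    intro a γ h
    refine ⟨0, fun _ => le_rfl, ?_⟩
    ext x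
    have h1 := h x (by simp)
    have h2 := h (-x) (by simp)
    rw [map_neg] at h2
    simp
    linarith
  | insert k s hk ih =>
    intro a γ h
    by_cases h' : ∀ x, (∀ i ∈ s, a i x ≤ 0) → γ x ≤ 0
    · obtain ⟨c, hc, e⟩ := ih a γ h'
      refine ⟨Function.update c k 0, fun i => ?_, ?_⟩
      · by_cases hi : i = k
        · subst hi; simp
        · simpa [hi] using hc i
      · rw [Finset.sum_insert hk, e]
        simp only [Function.update_self, zero_smul, zero_add]
        refine Finset.sum_congr rfl fun i hi => ?_
        rw [Function.update_of_ne (by rintro rfl; exact hk hi)]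
    · push Not at h'
      obtain ⟨y, hy, hγ⟩ := h'
      have hky : 0 < a k y := by
        by_contra! hcon
        refine absurd (h y fun i hi => ?_) (not_le.2 hγ)
        rcases Finset.mem_insert.1 hi with rfl | hi
        exacts [hcon, hy i hi]
      set x₀ : W := (a k y)⁻¹ • y with hx₀
      have hk1 : a k x₀ = 1 := by simp [hx₀, hky.ne']
      have hx0 : ∀ i ∈ s, a i x₀ ≤ 0 := fun i hi => by
        simpa [hx₀] using mul_nonpos_of_nonneg_of_nonpos (inv_nonneg.2 hky.le) (hy i hi)
      have hγ0 : 0 ≤ γ x₀ := by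
        simpa [hx₀] using mul_nonneg (inv_nonneg.2 hky.le) hγ.le
      obtain ⟨c, hc, e⟩ := ih (fun i => a i - a i x₀ • a k) (γ - γ x₀ • a k) (by
        intro x hx
        have := h (x - a k x • x₀) (by
          intro i hi
          rcases Finset.mem_insert.1 hi with rfl | hi
          · simp [hk1]
          · have := hx i hi
            simp only [LinearMap.sub_apply, LinearMap.smul_apply, smul_eq_mul, map_sub,
              map_smul] at this ⊢
            linarith)
        simp only [LinearMap.sub_apply, LinearMap.smul_apply, smul_eq_mul, map_sub,
          map_smul] at this ⊢
        linarith)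
      refine ⟨Function.update c k (γ x₀ - ∑ i ∈ s, c i * a i x₀), fun i => ?_, ?_⟩
      · by_cases hi : i = k
        · subst hi
          have : ∑ j ∈ s, c j * a j x₀ ≤ 0 :=
            Finset.sum_nonpos fun j hj => mul_nonpos_of_nonneg_of_nonpos (hc j) (hx0 j hj)
          simp only [Function.update_self]
          linarith
        · simpa [hi] using hc i
      · have e2 : ∑ i ∈ s, Function.update c k (γ x₀ - ∑ i ∈ s, c i * a i x₀) i • a i
            = ∑ i ∈ s, c i • a i := Finset.sum_congr rfl fun i hi => by
          rw [Function.update_of_ne (by rintro rfl; exact hk hi)]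
        rw [Finset.sum_insert hk, e2]
        ext x
        have := LinearMap.congr_fun e x
        simp only [LinearMap.sub_apply, LinearMap.smul_apply, smul_eq_mul, LinearMap.sum_apply,
          LinearMap.add_apply, Function.update_self, mul_sub, Finset.sum_sub_distrib] at this ⊢
        rw [sub_mul, Finset.sum_mul]
        simp only [mul_assoc] at this ⊢
        linarith

theorem exists_common_denominator {ι : Type*} [Fintype ι] (q : ι → ℚ) :
    ∃ D : ℕ, 0 < D ∧ ∀ i, ∃ z : ℤ, (D : ℚ) * q i = z := by
  classical
  refine ⟨∏ i, (q i).den, Finset.prod_pos fun i _ => (q i).den_pos, fun i => ?_⟩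
  obtain ⟨k, hk⟩ := Finset.dvd_prod_of_mem (fun i => (q i).den) (Finset.mem_univ i)
  refine ⟨k * (q i).num, ?_⟩
  rw [hk]
  push_cast
  have := Rat.den_mul_eq_num (q i)
  linear_combination (k : ℚ) * this

/-- The point of `ℝⁿ` with the given rational coordinates. -/
def ratPoint {n : ℕ} (q : Fin n → ℚ) : Fin n → ℝ := fun i => (q i : ℝ)

/-- Two rational polytopes can be separated, relative to an integer affine function that is
nonpositive on their intersection, by an integer affine function. -/
theorem exists_intAffine_separation {n : ℕ} (A B : Finset (Fin n → ℚ)) {d : (Fin n → ℝ) → ℝ}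
    (hd : IsIntAffine1 d)
    (h : ∀ x ∈ convexHull ℝ (ratPoint '' (A : Set (Fin n → ℚ))),
      x ∈ convexHull ℝ (ratPoint '' (B : Set (Fin n → ℚ))) → d x ≤ 0) :
    ∃ u, IsIntAffine1 u ∧ (∀ v ∈ B, u (ratPoint v) ≤ 0) ∧
      ∃ D : ℕ, 0 < D ∧ ∀ v ∈ A, D * d (ratPoint v) ≤ u (ratPoint v) := by
  classical
  obtain ⟨μ, b, hd⟩ := hd
  let δ : (Fin n → ℚ) → ℚ := fun v => ∑ j, (μ j : ℚ) * v j + b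
  have hδ : ∀ v, d (ratPoint v) = (δ v : ℝ) := fun v => by simp [hd, δ, ratPoint]
  -- the evaluation functional of a pair `(a, c)` at `v`
  let ev : (Fin n → ℚ) → ((Fin n → ℚ) × ℚ × ℚ) →ₗ[ℚ] ℚ := fun v =>
    (∑ j, v j • LinearMap.proj j) ∘ₗ LinearMap.fst ℚ _ _ +
      LinearMap.fst ℚ ℚ ℚ ∘ₗ LinearMap.snd ℚ _ _
  have hev : ∀ v a c t, ev v (a, c, t) = ∑ j, v j * a j + c := fun v a c t => by
    simp [ev]
  let τ : ((Fin n → ℚ) × ℚ × ℚ) →ₗ[ℚ] ℚ := LinearMap.snd ℚ ℚ ℚ ∘ₗ LinearMap.snd ℚ _ _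
  have hτ : ∀ a c t, τ (a, c, t) = t := fun a c t => by simp [τ]
  let φ : (Fin n → ℚ) ⊕ (Fin n → ℚ) → ((Fin n → ℚ) × ℚ × ℚ) →ₗ[ℚ] ℚ :=
    Sum.elim (fun v => δ v • τ - ev v) (fun v => ev v)
  by_cases hF : ∀ x, (∀ i ∈ A.disjSum B, φ i x ≤ 0) → τ x ≤ 0
  · exfalso
    obtain ⟨c, hc, e⟩ := exists_nonneg_combination_of_forall_nonpos _ φ τ hF
    have e' : ∀ (a : Fin n → ℚ) (s t : ℚ), t = ∑ v ∈ A, c (.inl v) * (δ v * t - (∑ j, v j * a j + s)) +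
        ∑ v ∈ B, c (.inr v) * (∑ j, v j * a j + s) := fun a s t => by
      have := LinearMap.congr_fun e (a, s, t)
      simpa [Finset.sum_disjSum, φ, LinearMap.sum_apply, hev, hτ] using this
    have e1 : 1 = ∑ v ∈ A, c (.inl v) * δ v := by simpa using e' 0 0 1
    have e2 : ∑ v ∈ A, c (.inl v) = ∑ v ∈ B, c (.inr v) := by
      have := e' 0 1 0
      simp at this
      linarith
    have e3 : ∀ j, ∑ v ∈ A, c (.inl v) * v j = ∑ v ∈ B, c (.inr v) * v j := fun j => by
      have := e' (Pi.single j 1) 0 0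
      simp [Pi.single_apply] at this
      linarith
    set s : ℚ := ∑ v ∈ A, c (.inl v) with hs
    have hs0 : 0 < s := by
      refine lt_of_le_of_ne (Finset.sum_nonneg fun v _ => hc _) fun h0 => ?_
      have := (Finset.sum_eq_zero_iff_of_nonneg (fun v _ => hc (.inl v))).1 h0.symm
      rw [Finset.sum_eq_zero (fun v hv => by rw [this v hv, zero_mul])] at e1
      exact one_ne_zero e1
    have hsA : 0 < ∑ v ∈ A, (c (.inl v) : ℝ) := by exact_mod_cast hs ▸ hs0
    have hsB : 0 < ∑ v ∈ B, (c (.inr v) : ℝ) := by exact_mod_cast e2 ▸ hs0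
    have hpA := Finset.centerMass_mem_convexHull A (R := ℝ) (w := fun v => (c (.inl v) : ℝ))
      (z := ratPoint) (s := ratPoint '' (A : Set (Fin n → ℚ)))
      (fun v _ => by exact_mod_cast hc _) hsA (fun v hv => mem_image_of_mem _ hv)
    have hpB := Finset.centerMass_mem_convexHull B (R := ℝ) (w := fun v => (c (.inr v) : ℝ))
      (z := ratPoint) (s := ratPoint '' (B : Set (Fin n → ℚ)))
      (fun v _ => by exact_mod_cast hc _) hsB (fun v hv => mem_image_of_mem _ hv)
    have heq : A.centerMass (fun v => (c (.inl v) : ℝ)) ratPoint =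
        B.centerMass (fun v => (c (.inr v) : ℝ)) ratPoint := by
      have e2' : ∑ v ∈ A, (c (.inl v) : ℝ) = ∑ v ∈ B, (c (.inr v) : ℝ) := by exact_mod_cast e2
      ext j
      have e3' : ∑ v ∈ A, (c (.inl v) : ℝ) * v j = ∑ v ∈ B, (c (.inr v) : ℝ) * v j := by
        exact_mod_cast e3 j
      simp [Finset.centerMass, Finset.sum_apply, ratPoint, e2', e3']
    have hle := h _ hpA (heq ▸ hpB)
    have : d (A.centerMass (fun v => (c (.inl v) : ℝ)) ratPoint) =
        (∑ v ∈ A, (c (.inl v) : ℝ))⁻¹ := by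
      have e1' : (1 : ℝ) = ∑ v ∈ A, (c (.inl v) : ℝ) * (∑ j, (μ j : ℝ) * v j + b) := by
        exact_mod_cast e1
      rw [hd]
      simp only [Finset.centerMass, ratPoint, Pi.smul_apply, Finset.sum_apply, smul_eq_mul]
      refine eq_inv_of_mul_eq_one_left ?_
      rw [add_mul, Finset.sum_mul]
      simp only [mul_add, Finset.sum_add_distrib, Finset.mul_sum] at e1'
      rw [e1', Finset.sum_comm, Finset.mul_sum]
      congr 1
      · refine Finset.sum_congr rfl fun j _ => ?_
        simp only [mul_left_comm _ (μ j : ℝ), ← Finset.mul_sum]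
        field_simp
      · exact Finset.sum_congr rfl fun v _ => mul_comm _ _
    rw [this] at hle
    exact absurd hle (not_le.2 (inv_pos.2 hsA))
  · push Not at hF
    obtain ⟨⟨a, c, t⟩, hx, ht⟩ := hF
    rw [hτ] at ht
    obtain ⟨D, hD, hz⟩ := exists_common_denominator
      (fun o : Option (Fin n) => o.elim (c / t) (fun j => a j / t))
    choose z hz using hz
    have hz0 : (D : ℝ) * (c / t : ℚ) = z none := by exact_mod_cast hz none
    have hzj : ∀ j, (D : ℝ) * (a j / t : ℚ) = z (some j) := fun j => by
      exact_mod_cast hz (some j)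
    have key : ∀ v : Fin n → ℚ, ∑ j, (z (some j) : ℝ) * ratPoint v j + z none =
        (D * ((∑ j, v j * a j + c) / t : ℚ) : ℝ) := fun v => by
      simp only [← hz0, ← hzj, ratPoint]
      push_cast
      rw [add_div, mul_add, Finset.sum_div, Finset.mul_sum]
      congr 1
      exact Finset.sum_congr rfl fun j _ => by ring
    refine ⟨_, ⟨fun j => z (some j), z none, fun x => rfl⟩, fun v hv => ?_, D, hD, fun v hv => ?_⟩
    · have := hx (.inr v) (by simpa using hv)
      simp only [φ, Sum.elim_inr, hev] at this
      rw [key]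
      refine mul_nonpos_of_nonneg_of_nonpos (Nat.cast_nonneg _) ?_
      exact_mod_cast div_nonpos_of_nonpos_of_nonneg this ht.le
    · have := hx (.inl v) (by simpa using hv)
      simp only [φ, Sum.elim_inl, LinearMap.sub_apply, LinearMap.smul_apply, hev, hτ,
        smul_eq_mul] at this
      rw [key, hδ]
      refine mul_le_mul_of_nonneg_left ?_ (Nat.cast_nonneg _)
      have : δ v ≤ (∑ j, v j * a j + c) / t := by
        rw [le_div_iff₀ ht]; linarith
      exact_mod_cast this

theorem IsIntAffine1.exists_affineMap {n : ℕ} {g : (Fin n → ℝ) → ℝ} (hg : IsIntAffine1 g) :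
    ∃ G : (Fin n → ℝ) →ᵃ[ℝ] ℝ, ⇑G = g := by
  obtain ⟨m, b, h⟩ := hg
  refine ⟨(∑ j, (m j : ℝ) • LinearMap.proj (R := ℝ) (φ := fun _ : Fin n => ℝ) j).toAffineMap +
    AffineMap.const ℝ _ (b : ℝ), ?_⟩
  ext x
  simp [h]

theorem IsIntAffine1.continuous {n : ℕ} {g : (Fin n → ℝ) → ℝ} (hg : IsIntAffine1 g) :
    Continuous g := by
  obtain ⟨m, b, h⟩ := hg
  rw [funext h]
  fun_prop

theorem IsIntAffine1.sub {n : ℕ} {g h : (Fin n → ℝ) → ℝ} (hg : IsIntAffine1 g)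
    (hh : IsIntAffine1 h) : IsIntAffine1 (fun x => g x - h x) := by
  obtain ⟨m, b, hg⟩ := hg
  obtain ⟨m', b', hh⟩ := hh
  refine ⟨m - m', b - b', fun x => ?_⟩
  simp [hg, hh, sub_mul, Finset.sum_sub_distrib]
  ring

theorem isIntAffine1_const {n : ℕ} (c : ℤ) : IsIntAffine1 (fun _ : Fin n → ℝ => (c : ℝ)) :=
  ⟨0, c, fun x => by simp⟩

theorem IsIntAffine1.add {n : ℕ} {g h : (Fin n → ℝ) → ℝ} (hg : IsIntAffine1 g)
    (hh : IsIntAffine1 h) : IsIntAffine1 (fun x => g x + h x) := by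
  simpa using hg.sub ((isIntAffine1_const 0).sub hh)

theorem IsIntAffine1.neg {n : ℕ} {g : (Fin n → ℝ) → ℝ} (hg : IsIntAffine1 g) :
    IsIntAffine1 (fun x => -g x) := by
  simpa using (isIntAffine1_const 0).sub hg

theorem IsIntAffine1.exists_ratCast {n : ℕ} {g : (Fin n → ℝ) → ℝ} (hg : IsIntAffine1 g) :
    ∃ δ : (Fin n → ℚ) → ℚ, ∀ v, g (ratPoint v) = δ v := by
  obtain ⟨m, b, h⟩ := hg
  exact ⟨fun v => ∑ j, (m j : ℚ) * v j + b, fun v => by simp [h, ratPoint]⟩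

theorem IsIntAffine1.convex_setOf_le {n : ℕ} {g : (Fin n → ℝ) → ℝ} (hg : IsIntAffine1 g) :
    Convex ℝ {x | g x ≤ 0} := by
  obtain ⟨G, rfl⟩ := hg.exists_affineMap
  exact (convex_Iic (0 : ℝ)).affine_preimage G

theorem IsIntAffine1.convex_setOf_lt {n : ℕ} {g : (Fin n → ℝ) → ℝ} (hg : IsIntAffine1 g) :
    Convex ℝ {x | 0 < g x} := by
  obtain ⟨G, rfl⟩ := hg.exists_affineMap
  exact (convex_Ioi (0 : ℝ)).affine_preimage G

/-- The convex hull of a finite set of rational points. -/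
def IsRatPolytope {n : ℕ} (T : Set (Fin n → ℝ)) : Prop :=
  ∃ F : Finset (Fin n → ℚ), T = convexHull ℝ (ratPoint '' (F : Set (Fin n → ℚ)))

/-- The zero of the affine function `G` on the line through `p` and `q`. -/
noncomputable def crossing {E : Type*} [AddCommGroup E] [Module ℝ E] (G : E →ᵃ[ℝ] ℝ) (p q : E) :
    E :=
  (G q - G p)⁻¹ • (G q • p - G p • q)

theorem crossing_neg {E : Type*} [AddCommGroup E] [Module ℝ E] (G : E →ᵃ[ℝ] ℝ) (p q : E) :
    crossing (-G) q p = crossing G p q := by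
  simp only [crossing, AffineMap.coe_neg, Pi.neg_apply]
  rw [show -G p - -G q = G q - G p by ring]
  congr 1
  module

theorem convex_setOf_crossing_mem {E : Type*} [AddCommGroup E] [Module ℝ E] (G : E →ᵃ[ℝ] ℝ)
    {K : Set E} (hK : Convex ℝ K) (q : E) : Convex ℝ {p | G p < G q ∧ crossing G p q ∈ K} := by
  rintro p ⟨hp, hpK⟩ p' ⟨hp', hpK'⟩ a b ha hb hab
  have hG : G (a • p + b • p') = a * G p + b * G p' := by
    simpa using Convex.combo_affine_apply (f := G) (x := p) (y := p') hab
  have hpos : 0 < a * (G q - G p) + b * (G q - G p') := by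
    rcases ha.eq_or_lt with rfl | ha
    · obtain rfl : b = 1 := by linarith
      linarith
    · have := mul_pos ha (sub_pos.2 hp)
      have := mul_nonneg hb (sub_pos.2 hp').le
      linarith
  set D := a * (G q - G p) + b * (G q - G p') with hD
  have hDq : G q - G (a • p + b • p') = D := by rw [hG, hD]; linear_combination (-G q) * hab
  refine ⟨by linarith, ?_⟩
  have := hK hpK hpK' (a := a * (G q - G p) / D) (b := b * (G q - G p') / D)
    (div_nonneg (mul_nonneg ha (sub_pos.2 hp).le) hpos.le)
    (div_nonneg (mul_nonneg hb (sub_pos.2 hp').le) hpos.le)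
    (by rw [← add_div, ← hD, div_self hpos.ne'])
  convert this using 1
  simp only [crossing, hDq]
  have h1 : G q - G p ≠ 0 := (sub_pos.2 hp).ne'
  have h2 : G q - G p' ≠ 0 := (sub_pos.2 hp').ne'
  rw [smul_smul, smul_smul, div_mul_eq_mul_div, mul_inv_cancel_right₀ h1, div_mul_eq_mul_div,
    mul_inv_cancel_right₀ h2, hG]
  module

theorem IsRatPolytope.inter_setOf_le {n : ℕ} {T : Set (Fin n → ℝ)} (hT : IsRatPolytope T)
    {g : (Fin n → ℝ) → ℝ} (hg : IsIntAffine1 g) : IsRatPolytope (T ∩ {x | g x ≤ 0}) := by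
  classical
  obtain ⟨F, rfl⟩ := hT
  obtain ⟨δ, hδ⟩ := hg.exists_ratCast
  have hcl := hg.convex_setOf_le
  have hcg := hg.convex_setOf_lt
  obtain ⟨G, rfl⟩ := hg.exists_affineMap
  let N := F.filter (fun v => δ v ≤ 0)
  let R := F.filter (fun v => 0 < δ v)
  let z : (Fin n → ℚ) → (Fin n → ℚ) → (Fin n → ℚ) := fun v w =>
    (δ w - δ v)⁻¹ • (δ w • v - δ v • w)
  have hz : ∀ v w, ratPoint (z v w) = crossing G (ratPoint v) (ratPoint w) := fun v w => by
    ext i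
    simp [crossing, hδ, ratPoint, z]
  have hNR : (F : Set (Fin n → ℚ)) = (N : Set (Fin n → ℚ)) ∪ (R : Set (Fin n → ℚ)) := by
    ext v
    have := le_or_gt (δ v) 0
    simp only [N, R, Finset.coe_filter, mem_union, Set.mem_ofPred_eq, Finset.mem_coe]
    tauto
  have hNl : convexHull ℝ (ratPoint '' (N : Set (Fin n → ℚ))) ⊆ {x | G x ≤ 0} := by
    refine convexHull_min ?_ hcl
    rintro _ ⟨v, hv, rfl⟩
    have : δ v ≤ 0 := (Finset.mem_filter.1 hv).2
    simpa [hδ] using this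
  have hRg : convexHull ℝ (ratPoint '' (R : Set (Fin n → ℚ))) ⊆ {x | 0 < G x} := by
    refine convexHull_min ?_ hcg
    rintro _ ⟨v, hv, rfl⟩
    have : 0 < δ v := (Finset.mem_filter.1 hv).2
    simpa [hδ] using this
  refine ⟨N ∪ Finset.image₂ z N R, Subset.antisymm ?_ ?_⟩
  · set K := convexHull ℝ (ratPoint '' ((N ∪ Finset.image₂ z N R : Finset _) : Set (Fin n → ℚ)))
      with hK
    have hKc : Convex ℝ K := convex_convexHull _ _
    have hNK : convexHull ℝ (ratPoint '' (N : Set (Fin n → ℚ))) ⊆ K :=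
      convexHull_mono (image_mono (by simp))
    rintro x ⟨hx, hx0⟩
    have hx0 : G x ≤ 0 := hx0
    rw [hNR, image_union] at hx
    rcases (R : Set (Fin n → ℚ)).eq_empty_or_nonempty with hR | hR
    · rw [hR, image_empty, union_empty] at hx
      exact hNK hx
    rcases (N : Set (Fin n → ℚ)).eq_empty_or_nonempty with hN | hN
    · rw [hN, image_empty, empty_union] at hx
      exact absurd (hRg hx) (not_lt.2 hx0)
    rw [convexHull_union (hN.image _) (hR.image _), mem_convexJoin] at hx
    obtain ⟨p, hp, q, hq, a, b, ha, hb, hab, rfl⟩ := hx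
    have hp0 : G p ≤ 0 := hNl hp
    have hq0 : 0 < G q := hRg hq
    have hG : G (a • p + b • q) = a * G p + b * G q := by
      simpa using Convex.combo_affine_apply (f := G) (x := p) (y := q) hab
    rcases hp0.eq_or_lt with hp0 | hp0
    · have : b = 0 := by
        rw [hG, hp0] at hx0
        by_contra hne
        have := mul_pos (lt_of_le_of_ne hb (Ne.symm hne)) hq0
        linarith
      obtain rfl : a = 1 := by linarith
      simpa [this] using hNK hp
    have hcross : crossing G p q ∈ K := by
      have h1 : ∀ w ∈ R, crossing G p (ratPoint w) ∈ K := fun w hw => by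
        refine (convexHull_min ?_ (convex_setOf_crossing_mem G hKc (ratPoint w)) hp).2
        rintro _ ⟨v, hv, rfl⟩
        have hv0 : δ v ≤ 0 := (Finset.mem_filter.1 hv).2
        have hw0 : 0 < δ w := (Finset.mem_filter.1 hw).2
        refine ⟨?_, ?_⟩
        · rw [hδ, hδ]
          exact_mod_cast hv0.trans_lt hw0
        · rw [← hz]
          refine subset_convexHull _ _ (mem_image_of_mem _ ?_)
          simp only [Finset.coe_union, Finset.coe_image₂]
          exact Or.inr (mem_image2_of_mem hv hw)
      have h2 := (convexHull_min ?_ (convex_setOf_crossing_mem (-G) hKc p) hq).2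
      · rwa [crossing_neg] at h2
      rintro _ ⟨w, hw, rfl⟩
      refine ⟨?_, ?_⟩
      · have : 0 < G (ratPoint w) := hRg (subset_convexHull _ _ (mem_image_of_mem _ hw))
        simp only [AffineMap.coe_neg, Pi.neg_apply]
        linarith
      · rw [crossing_neg]
        exact h1 w hw
    rw [hG] at hx0
    have := hKc (hNK hp) hcross (a := 1 - b * (G q - G p) / (-G p))
      (b := b * (G q - G p) / (-G p)) ?_ ?_ (by ring)
    · convert this using 1
      have h1 : G q - G p ≠ 0 := by linarith
      have h2 : G p ≠ 0 := hp0.ne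
      obtain rfl : a = 1 - b := by linarith
      ext i
      simp only [crossing, Pi.add_apply, Pi.smul_apply, Pi.sub_apply, smul_eq_mul]
      field_simp
      ring
    · rw [sub_nonneg, div_le_one (by linarith)]
      obtain rfl : a = 1 - b := by linarith
      linarith
    · exact div_nonneg (mul_nonneg hb (by linarith)) (by linarith)
  · refine convexHull_min ?_ ((convex_convexHull _ _).inter hcl)
    rintro _ ⟨v, hv, rfl⟩
    rcases Finset.mem_union.1 hv with hv | hv
    · exact ⟨subset_convexHull _ _ (mem_image_of_mem _ (Finset.mem_filter.1 hv).1),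
        hNl (subset_convexHull _ _ (mem_image_of_mem _ hv))⟩
    · obtain ⟨v, hvN, w, hw, rfl⟩ := Finset.mem_image₂.1 hv
      have hv0 : δ v ≤ 0 := (Finset.mem_filter.1 hvN).2
      have hw0 : 0 < δ w := (Finset.mem_filter.1 hw).2
      have hv0' : G (ratPoint v) ≤ 0 := by rw [hδ]; exact_mod_cast hv0
      have hw0' : 0 < G (ratPoint w) := by rw [hδ]; exact_mod_cast hw0
      have hpos : 0 < G (ratPoint w) - G (ratPoint v) := by linarith
      have e : ratPoint (z v w) =
          (G (ratPoint w) / (G (ratPoint w) - G (ratPoint v))) • ratPoint v +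
          (-G (ratPoint v) / (G (ratPoint w) - G (ratPoint v))) • ratPoint w := by
        rw [hz, crossing]
        module
      have hsum : G (ratPoint w) / (G (ratPoint w) - G (ratPoint v)) +
          -G (ratPoint v) / (G (ratPoint w) - G (ratPoint v)) = 1 := by
        rw [← add_div, ← sub_eq_add_neg, div_self hpos.ne']
      refine ⟨?_, ?_⟩
      · rw [e]
        exact convex_convexHull ℝ _
          (subset_convexHull _ _ (mem_image_of_mem _ (Finset.mem_filter.1 hvN).1))
          (subset_convexHull _ _ (mem_image_of_mem _ (Finset.mem_filter.1 hw).1))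
          (div_nonneg hw0'.le hpos.le) (div_nonneg (by linarith) hpos.le) hsum
      · have := Convex.combo_affine_apply (f := G) (x := ratPoint v) (y := ratPoint w) hsum
        simp only [smul_eq_mul] at this
        show G _ ≤ 0
        rw [e, this]
        apply le_of_eq
        field_simp
        ring

theorem IsRatPolytope.inter_setOf_forall_le {n : ℕ} {T : Set (Fin n → ℝ)} (hT : IsRatPolytope T)
    {κ : Type*} (s : Finset κ) (g : κ → (Fin n → ℝ) → ℝ) (hg : ∀ i, IsIntAffine1 (g i)) :
    IsRatPolytope (T ∩ {x | ∀ i ∈ s, g i x ≤ 0}) := by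
  classical
  induction s using Finset.induction_on with
  | empty => simpa using hT
  | insert k s hk ih =>
    convert ih.inter_setOf_le (hg k) using 1
    ext x
    simp only [mem_inter_iff, Set.mem_ofPred_eq, Finset.forall_mem_insert]
    tauto

theorem IsRationalPolyhedron.exists_iUnion {n : ℕ} {P : Set (Fin n → ℝ)}
    (hP : IsRationalPolyhedron P) :
    ∃ (ι : Type) (_ : Fintype ι) (T : ι → Set (Fin n → ℝ)),
      (∀ i, IsRatPolytope (T i)) ∧ P = ⋃ i, T i := by
  classical
  obtain ⟨S, hS, rfl⟩ := hP
  refine ⟨Fin S.card, inferInstance, fun i => convexHull ℝ ((S.equivFin.symm i).1 : Set _), ?_, ?_⟩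
  · intro i
    have : ((S.equivFin.symm i).1 : Set (Fin n → ℝ)) ⊆ ratPoint '' (univ : Set (Fin n → ℚ)) := by
      intro v hv
      choose q hq using hS _ (S.equivFin.symm i).2 v hv
      exact ⟨q, trivial, funext fun j => (hq j).symm⟩
    obtain ⟨F, -, hF⟩ := Finset.subset_set_image_iff.1 this
    exact ⟨F, by rw [← Finset.coe_image, hF]⟩
  · rw [S.equivFin.symm.surjective.iUnion_comp
      (fun F : S => convexHull ℝ (F.1 : Set (Fin n → ℝ))), iUnion_subtype]

theorem IsRatPolytope.convex {n : ℕ} {T : Set (Fin n → ℝ)} (hT : IsRatPolytope T) :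
    Convex ℝ T := by
  obtain ⟨F, rfl⟩ := hT
  exact convex_convexHull _ _

theorem IsRatPolytope.isCompact {n : ℕ} {T : Set (Fin n → ℝ)} (hT : IsRatPolytope T) :
    IsCompact T := by
  obtain ⟨F, rfl⟩ := hT
  exact (F.finite_toSet.image _).isCompact_convexHull (𝕜 := ℝ)

theorem IsRationalPolyhedron.isClosed {n : ℕ} {P : Set (Fin n → ℝ)}
    (hP : IsRationalPolyhedron P) : IsClosed P := by
  obtain ⟨ι, _, T, hT, rfl⟩ := hP.exists_iUnion
  exact isClosed_iUnion_of_finite fun i => (hT i).isCompact.isClosed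

/-- On a preconnected set, a continuous selection of finitely many continuous functions that are
pairwise either equal everywhere or nowhere is one of these functions. -/
theorem exists_eqOn_of_isPreconnected {X Y κ : Type*} [TopologicalSpace X] [TopologicalSpace Y]
    [T2Space Y] [Finite κ] [Nonempty κ] {C : Set X} (hC : IsPreconnected C) {f : X → Y}
    (hf : ContinuousOn f C) {h : κ → X → Y} (hh : ∀ i, ContinuousOn (h i) C)
    (hsel : ∀ x ∈ C, ∃ i, f x = h i x)
    (hd : ∀ i j, EqOn (h i) (h j) C ∨ ∀ x ∈ C, h i x ≠ h j x) : ∃ i, EqOn f (h i) C := by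
  rcases C.eq_empty_or_nonempty with rfl | ⟨c, hc⟩
  · exact ⟨Classical.arbitrary κ, eqOn_empty _ _⟩
  obtain ⟨i, hi⟩ := hsel c hc
  refine ⟨i, ?_⟩
  have : PreconnectedSpace C := isPreconnected_iff_preconnectedSpace.1 hC
  have hcl : ∀ j, IsClosed {x : C | f x = h j x} := fun j =>
    isClosed_eq hf.domRestrict (hh j).domRestrict
  have hop : IsOpen {x : C | f x = h i x} := by
    rw [← isClosed_compl_iff]
    have : {x : C | f x = h i x}ᶜ = ⋃ j ∈ {j | ∀ x ∈ C, h i x ≠ h j x}, {x : C | f x = h j x} := by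
      ext x
      simp only [mem_compl_iff, Set.mem_ofPred_eq, mem_iUnion, exists_prop]
      constructor
      · intro hx
        obtain ⟨j, hj⟩ := hsel x x.2
        refine ⟨j, (hd i j).resolve_left fun he => hx ?_, hj⟩
        rw [hj, he x.2]
      · rintro ⟨j, hj, hx⟩ hx'
        exact hj x x.2 (hx'.symm.trans hx)
    rw [this]
    exact (Set.toFinite _).isClosed_biUnion fun j _ => hcl j
  rcases isClopen_iff.1 ⟨hcl i, hop⟩ with h0 | h1
  · exact absurd (show (⟨c, hc⟩ : C) ∈ {x : C | f x = h i x} from hi) (by simp [h0])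
  · intro x hx
    exact (show (⟨x, hx⟩ : C) ∈ {x : C | f x = h i x} by rw [h1]; trivial)

/-- The set of points at which the functions `ℓ k` have the prescribed signs. -/
def signCell {X κ : Type*} (ℓ : κ → X → ℝ) (s : κ → SignType) : Set X :=
  {x | ∀ k, SignType.sign (ℓ k x) = s k}

theorem combo_mem_signCell {n : ℕ} {κ : Type*} {ℓ : κ → (Fin n → ℝ) → ℝ}
    (hℓ : ∀ k, IsIntAffine1 (ℓ k)) {s : κ → SignType} {c x : Fin n → ℝ} (hc : c ∈ signCell ℓ s)
    (hx : ∀ k, (s k ≤ 0 → ℓ k x ≤ 0) ∧ (0 ≤ s k → 0 ≤ ℓ k x)) {a b : ℝ} (ha : 0 ≤ a) (hb : 0 < b)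
    (hab : a + b = 1) : a • x + b • c ∈ signCell ℓ s := by
  intro k
  obtain ⟨G, hG⟩ := (hℓ k).exists_affineMap
  have e : ℓ k (a • x + b • c) = a * ℓ k x + b * ℓ k c := by
    simpa [hG] using Convex.combo_affine_apply (f := G) (x := x) (y := c) hab
  have hck := hc k
  have hxk := hx k
  rw [← hck, e]
  rcases lt_trichotomy (ℓ k c) 0 with h | h | h
  · rw [← hck, sign_neg h] at hxk
    have := mul_nonpos_of_nonneg_of_nonpos ha (hxk.1 (by decide))
    have := mul_neg_of_pos_of_neg hb h
    rw [sign_neg h, sign_neg (by linarith)]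
  · rw [← hck, h, sign_zero] at hxk
    have : ℓ k x = 0 := le_antisymm (hxk.1 le_rfl) (hxk.2 le_rfl)
    simp [this, h]
  · rw [← hck, sign_pos h] at hxk
    have := mul_nonneg ha (hxk.2 (by decide))
    have := mul_pos hb h
    rw [sign_pos h, sign_pos (by linarith)]

theorem le_zero_and_zero_le_of_mem_signCell {X κ : Type*} {ℓ : κ → X → ℝ} {s : κ → SignType} {x : X}
    (hx : x ∈ signCell ℓ s) (k : κ) : (s k ≤ 0 → ℓ k x ≤ 0) ∧ (0 ≤ s k → 0 ≤ ℓ k x) := by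
  rw [← hx k]
  exact ⟨sign_nonpos_iff.1, sign_nonneg_iff.1⟩

theorem convex_signCell {n : ℕ} {κ : Type*} {ℓ : κ → (Fin n → ℝ) → ℝ}
    (hℓ : ∀ k, IsIntAffine1 (ℓ k)) (s : κ → SignType) : Convex ℝ (signCell ℓ s) := by
  intro x hx y hy a b ha hb hab
  rcases hb.eq_or_lt with rfl | hb
  · obtain rfl : a = 1 := by linarith
    simpa using hx
  · exact combo_mem_signCell hℓ hy (le_zero_and_zero_le_of_mem_signCell hx) ha hb hab

theorem eq_or_ne_on_signCell {X κ : Type*} {ℓ : κ → X → ℝ} (s : κ → SignType) (k : κ) :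
    (∀ x ∈ signCell ℓ s, ℓ k x = 0) ∨ ∀ x ∈ signCell ℓ s, ℓ k x ≠ 0 := by
  by_cases h : s k = 0
  · exact Or.inl fun x hx => sign_eq_zero_iff.1 ((hx k).trans h)
  · exact Or.inr fun x hx h0 => h ((hx k).symm.trans (sign_eq_zero_iff.2 h0))

/-- A rational polyhedron can be subdivided into rational polytopes on which a given scalar Z-map
is integer affine. -/
theorem IsZMapOn1.exists_cells {n : ℕ} {Q : Set (Fin n → ℝ)} (hQ : IsRationalPolyhedron Q)
    {f : (Fin n → ℝ) → ℝ} (hf : IsZMapOn1 Q f) :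
    ∃ (ι : Type) (_ : Fintype ι) (T : ι → Set (Fin n → ℝ)) (g : ι → (Fin n → ℝ) → ℝ),
      (∀ i, IsRatPolytope (T i)) ∧ (∀ i, IsIntAffine1 (g i)) ∧ Q = ⋃ i, T i ∧
      ∀ i, EqOn f (g i) (T i) := by
  classical
  obtain ⟨ι, _, T, hT, rfl⟩ := hQ.exists_iUnion
  obtain ⟨hfc, k, g, hg, hsel⟩ := hf
  let ℓ : Fin k × Fin k → (Fin n → ℝ) → ℝ := fun p x => g p.1 x - g p.2 x
  have hℓ : ∀ p, IsIntAffine1 (ℓ p) := fun p => (hg p.1).sub (hg p.2)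
  let D : ι → (Fin k × Fin k → SignType) → Set (Fin n → ℝ) := fun i s =>
    T i ∩ {x | ∀ p, (s p ≤ 0 → ℓ p x ≤ 0) ∧ (0 ≤ s p → 0 ≤ ℓ p x)}
  have hD : ∀ i s, IsRatPolytope (D i s) := fun i s => by
    let e : (Fin k × Fin k) ⊕ (Fin k × Fin k) → (Fin n → ℝ) → ℝ :=
      Sum.elim (fun p x => if s p ≤ 0 then ℓ p x else ((0 : ℤ) : ℝ))
        (fun p x => if 0 ≤ s p then -ℓ p x else ((0 : ℤ) : ℝ))
    have he : ∀ i, IsIntAffine1 (e i) := by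
      rintro (p | p)
      · by_cases h : s p ≤ 0
        · simpa [e, h] using hℓ p
        · simpa [e, h] using isIntAffine1_const 0
      · by_cases h : 0 ≤ s p
        · simpa [e, h] using (hℓ p).neg
        · simpa [e, h] using isIntAffine1_const 0
    convert (hT i).inter_setOf_forall_le Finset.univ e he using 1
    ext x
    simp only [D, e, mem_inter_iff, Set.mem_ofPred_eq, Finset.mem_univ, true_imp_iff, Sum.forall,
      Sum.elim_inl, Sum.elim_inr, ← forall_and]
    refine and_congr_right fun _ => forall_congr' fun p => and_congr ?_ ?_
    · by_cases h : s p ≤ 0 <;> simp [h]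
    · by_cases h : 0 ≤ s p <;> simp [h]
  have hsub : ∀ i, T i ⊆ ⋃ i, T i := fun i => subset_iUnion T i
  have key : ∀ a : {a : ι × (Fin k × Fin k → SignType) // (T a.1 ∩ signCell ℓ a.2).Nonempty},
      ∃ i, EqOn f (g i) (D a.1.1 a.1.2) := by
    rintro ⟨⟨i, s⟩, c, hc⟩
    have : Nonempty (Fin k) := ⟨(hsel c (hsub i hc.1)).choose⟩
    obtain ⟨j, hj⟩ := exists_eqOn_of_isPreconnected (C := T i ∩ signCell ℓ s)
      ((hT i).convex.inter (convex_signCell hℓ s)).isPreconnected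
      (hfc.mono (inter_subset_left.trans (hsub i))) (fun j => (hg j).continuous.continuousOn)
      (fun x hx => hsel x (hsub i hx.1)) (fun j j' => by
        rcases eq_or_ne_on_signCell (ℓ := ℓ) s (j, j') with h | h
        · exact Or.inl fun x hx => sub_eq_zero.1 (h x hx.2)
        · exact Or.inr fun x hx => sub_ne_zero.1 (h x hx.2))
    refine ⟨j, hj.of_subset_closure (hfc.mono (inter_subset_left.trans (hsub i)))
      (hg j).continuous.continuousOn
      (fun x hx => ⟨hx.1, le_zero_and_zero_le_of_mem_signCell hx.2⟩) ?_⟩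
    rintro x ⟨hxT, hx⟩
    have ht : Filter.Tendsto (fun t : ℝ => (1 - t) • x + t • c) (nhdsWithin 0 (Ioi 0)) (nhds x) := by
      have : Continuous fun t : ℝ => (1 - t) • x + t • c := by fun_prop
      have := this.tendsto 0
      simp only [sub_zero, one_smul, zero_smul, add_zero] at this
      exact this.mono_left nhdsWithin_le_nhds
    refine mem_closure_of_tendsto ht ?_
    filter_upwards [Ioo_mem_nhdsGT (zero_lt_one' ℝ)] with t ht
    exact ⟨(hT i).convex hxT hc.1 (by linarith [ht.2]) ht.1.le (by ring),
      combo_mem_signCell hℓ hc.2 hx (by linarith [ht.2]) ht.1 (by ring)⟩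
  choose j hj using key
  refine ⟨_, inferInstance, fun a => D a.1.1 a.1.2, fun a => g (j a), fun a => hD _ _,
    fun a => hg _, Subset.antisymm ?_ ?_, hj⟩
  · refine iUnion_subset fun i x hx => ?_
    let s : Fin k × Fin k → SignType := fun p => SignType.sign (ℓ p x)
    have hxs : x ∈ signCell ℓ s := fun p => rfl
    exact mem_iUnion.2 ⟨⟨(i, s), x, hx, hxs⟩, hx, le_zero_and_zero_le_of_mem_signCell hxs⟩
  · exact iUnion_subset fun a => inter_subset_left.trans (hsub _)

theorem isZMapOn1_of_finite {n : ℕ} {κ : Type*} [Finite κ] {P : Set (Fin n → ℝ)}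
    {f : (Fin n → ℝ) → ℝ} (hf : ContinuousOn f P) (g : κ → (Fin n → ℝ) → ℝ)
    (hg : ∀ i, IsIntAffine1 (g i)) (h : ∀ x ∈ P, ∃ i, f x = g i x) : IsZMapOn1 P f := by
  let e := Finite.equivFin κ
  refine ⟨hf, _, fun i => g (e.symm i), fun i => hg _, fun x hx => ?_⟩
  obtain ⟨i, hi⟩ := h x hx
  exact ⟨e i, by simpa using hi⟩

theorem isZMapOn_of_finite {n m : ℕ} {κ : Type*} [Finite κ] {P : Set (Fin n → ℝ)}
    {f : (Fin n → ℝ) → (Fin m → ℝ)} (hf : ContinuousOn f P) (g : κ → (Fin n → ℝ) → (Fin m → ℝ))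
    (hg : ∀ i, IsIntAffine (g i)) (h : ∀ x ∈ P, ∃ i, f x = g i x) : IsZMapOn P f := by
  let e := Finite.equivFin κ
  refine ⟨hf, _, fun i => g (e.symm i), fun i => hg _, fun x hx => ?_⟩
  obtain ⟨i, hi⟩ := h x hx
  exact ⟨e i, by simpa using hi⟩

theorem IsIntAffine1.isZMapOn1 {n : ℕ} {g : (Fin n → ℝ) → ℝ} (hg : IsIntAffine1 g)
    (P : Set (Fin n → ℝ)) : IsZMapOn1 P g :=
  ⟨hg.continuous.continuousOn, 1, fun _ => g, fun _ => hg, fun _ _ => ⟨0, rfl⟩⟩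

theorem IsZMapOn1.sup {n : ℕ} {P : Set (Fin n → ℝ)} {f g : (Fin n → ℝ) → ℝ}
    (hf : IsZMapOn1 P f) (hg : IsZMapOn1 P g) : IsZMapOn1 P (f ⊔ g) := by
  obtain ⟨hfc, k, a, ha, hfa⟩ := hf
  obtain ⟨hgc, l, b, hb, hgb⟩ := hg
  refine isZMapOn1_of_finite (hfc.sup hgc) (Sum.elim a b) (Sum.forall.2 ⟨ha, hb⟩) fun x hx => ?_
  rcases max_choice (f x) (g x) with h | h
  · obtain ⟨i, hi⟩ := hfa x hx
    exact ⟨.inl i, h.trans hi⟩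
  · obtain ⟨i, hi⟩ := hgb x hx
    exact ⟨.inr i, h.trans hi⟩

theorem IsZMapOn1.inf {n : ℕ} {P : Set (Fin n → ℝ)} {f g : (Fin n → ℝ) → ℝ}
    (hf : IsZMapOn1 P f) (hg : IsZMapOn1 P g) : IsZMapOn1 P (f ⊓ g) := by
  obtain ⟨hfc, k, a, ha, hfa⟩ := hf
  obtain ⟨hgc, l, b, hb, hgb⟩ := hg
  refine isZMapOn1_of_finite (hfc.inf hgc) (Sum.elim a b) (Sum.forall.2 ⟨ha, hb⟩) fun x hx => ?_
  rcases min_choice (f x) (g x) with h | h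
  · obtain ⟨i, hi⟩ := hfa x hx
    exact ⟨.inl i, h.trans hi⟩
  · obtain ⟨i, hi⟩ := hgb x hx
    exact ⟨.inr i, h.trans hi⟩

/-- Two integer affine functions that agree on the intersection of two rational polytopes can be
interpolated by a Z-map. -/
theorem exists_isZMapOn1_between {n : ℕ} {T₁ T₂ : Set (Fin n → ℝ)} (hT₁ : IsRatPolytope T₁)
    (hT₂ : IsRatPolytope T₂) {g₁ g₂ : (Fin n → ℝ) → ℝ} (hg₁ : IsIntAffine1 g₁)
    (hg₂ : IsIntAffine1 g₂) (h : ∀ x ∈ T₁, x ∈ T₂ → g₁ x = g₂ x) :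
    ∃ u, IsZMapOn1 univ u ∧ (∀ x ∈ T₁, g₁ x ≤ u x) ∧ ∀ x ∈ T₂, u x ≤ g₂ x := by
  obtain ⟨A, rfl⟩ := hT₁
  obtain ⟨B, rfl⟩ := hT₂
  have hd := hg₁.sub hg₂
  obtain ⟨w, hw, hwB, D, hD, hwA⟩ := exists_intAffine_separation A B hd
    (fun x hx hx' => (sub_eq_zero.2 (h x hx hx')).le)
  refine ⟨g₂ ⊔ fun x => g₂ x + w x, (hg₂.isZMapOn1 _).sup ((hg₂.add hw).isZMapOn1 _),
    fun x hx => ?_, fun x hx => ?_⟩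
  · have hle : D * (g₁ x - g₂ x) ≤ w x := by
      obtain ⟨d, hd⟩ := hd.exists_affineMap
      obtain ⟨W, rfl⟩ := hw.exists_affineMap
      have hconv : Convex ℝ {x | D * (g₁ x - g₂ x) ≤ W x} := by
        have e : {x | D * (g₁ x - g₂ x) ≤ W x} = ((D : ℝ) • d - W) ⁻¹' Iic 0 := by
          ext x
          simp [hd]
        rw [e]
        exact (convex_Iic (0 : ℝ)).affine_preimage _
      refine convexHull_min ?_ hconv hx
      rintro _ ⟨v, hv, rfl⟩
      exact hwA v hv
    rcases le_total (g₁ x) (g₂ x) with h0 | h0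
    · exact le_sup_of_le_left h0
    · refine le_sup_of_le_right ?_
      have : (1 : ℝ) ≤ D := by exact_mod_cast hD
      have := mul_le_mul_of_nonneg_right this (sub_nonneg.2 h0)
      show g₁ x ≤ g₂ x + w x
      linarith
  · have : w x ≤ 0 := by
      refine convexHull_min ?_ hw.convex_setOf_le hx
      rintro _ ⟨v, hv, rfl⟩
      exact hwB v hv
    exact sup_le le_rfl (by linarith)

/-- A scalar Z-map on a rational polyhedron extends to a Z-map on the whole space. -/
theorem IsZMapOn1.exists_extension {n : ℕ} {Q : Set (Fin n → ℝ)} (hQ : IsRationalPolyhedron Q)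
    {f : (Fin n → ℝ) → ℝ} (hf : IsZMapOn1 Q f) : ∃ F, IsZMapOn1 univ F ∧ EqOn F f Q := by
  obtain ⟨ι, _, T, g, hT, hg, rfl, hfg⟩ := hf.exists_cells hQ
  rcases isEmpty_or_nonempty ι with hι | hι
  · exact ⟨_, (isIntAffine1_const 0).isZMapOn1 _, fun x hx => by simp at hx⟩
  have := fun i j => exists_isZMapOn1_between (hT i) (hT j) (hg i) (hg j)
    fun x hi hj => (hfg i hi).symm.trans (hfg j hj)
  choose u hu hul hur using this
  have hne : (Finset.univ : Finset ι).Nonempty := Finset.univ_nonempty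
  refine ⟨Finset.univ.sup' hne fun i => Finset.univ.inf' hne (u i), ?_, fun x hx => ?_⟩
  · refine Finset.sup'_induction hne _ (p := IsZMapOn1 univ) (fun _ h _ h' => h.sup h') fun i _ => ?_
    exact Finset.inf'_induction hne _ (p := IsZMapOn1 univ) (fun _ h _ h' => h.inf h')
      fun j _ => hu i j
  · obtain ⟨j, hj⟩ := mem_iUnion.1 hx
    rw [hfg j hj]
    simp only [Finset.sup'_apply, Finset.inf'_apply]
    refine le_antisymm (Finset.sup'_le _ _ fun i _ => ?_) ?_
    · exact (Finset.inf'_le _ (Finset.mem_univ j)).trans (hur i j x hj)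
    · exact (Finset.le_inf' hne _ fun k _ => hul j k x hj).trans
        (Finset.le_sup' (fun i => Finset.univ.inf' hne fun k => u i k x) (Finset.mem_univ j))

theorem IsIntAffine.apply {n m : ℕ} {g : (Fin n → ℝ) → (Fin m → ℝ)} (hg : IsIntAffine g)
    (i : Fin m) : IsIntAffine1 (fun x => g x i) := by
  obtain ⟨M, b, h⟩ := hg
  exact ⟨M i, b i, fun x => h x i⟩

theorem isIntAffine_of_apply {n m : ℕ} {g : (Fin n → ℝ) → (Fin m → ℝ)}
    (hg : ∀ i, IsIntAffine1 (fun x => g x i)) : IsIntAffine g := by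
  choose M b h using hg
  exact ⟨M, b, fun x i => h i x⟩

theorem IsIntAffine.continuous {n m : ℕ} {g : (Fin n → ℝ) → (Fin m → ℝ)} (hg : IsIntAffine g) :
    Continuous g :=
  continuous_pi fun i => (hg.apply i).continuous

theorem IsIntAffine.exists_affineMap {n m : ℕ} {g : (Fin n → ℝ) → (Fin m → ℝ)}
    (hg : IsIntAffine g) : ∃ G : (Fin n → ℝ) →ᵃ[ℝ] (Fin m → ℝ), ⇑G = g := by
  choose G hG using fun i => (hg.apply i).exists_affineMap
  refine ⟨AffineMap.pi G, ?_⟩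
  ext x i
  simpa using congrFun (hG i) x

theorem IsIntAffine.comp {n m l : ℕ} {g : (Fin m → ℝ) → (Fin l → ℝ)}
    {f : (Fin n → ℝ) → (Fin m → ℝ)} (hg : IsIntAffine g) (hf : IsIntAffine f) :
    IsIntAffine (g ∘ f) := by
  obtain ⟨M, b, hg⟩ := hg
  obtain ⟨N, c, hf⟩ := hf
  refine ⟨fun i k => ∑ j, M i j * N j k, fun i => ∑ j, M i j * c j + b i, fun x i => ?_⟩
  simp only [Function.comp, hg, hf, mul_add, Finset.sum_add_distrib, Finset.mul_sum]
  push_cast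
  rw [← add_assoc, Finset.sum_comm]
  simp only [Finset.sum_mul, mul_assoc]

theorem IsZMapOn.apply {n m : ℕ} {P : Set (Fin n → ℝ)} {f : (Fin n → ℝ) → (Fin m → ℝ)}
    (hf : IsZMapOn P f) (i : Fin m) : IsZMapOn1 P (fun x => f x i) := by
  obtain ⟨hc, k, g, hg, h⟩ := hf
  exact ⟨(continuous_apply i).comp_continuousOn hc, k, fun j x => g j x i, fun j => (hg j).apply i,
    fun x hx => (h x hx).imp fun j hj => congrFun hj i⟩

theorem isZMapOn_of_apply {n m : ℕ} {P : Set (Fin n → ℝ)} {f : (Fin n → ℝ) → (Fin m → ℝ)}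
    (hf : ∀ i, IsZMapOn1 P (fun x => f x i)) : IsZMapOn P f := by
  have hc := fun i => (hf i).1
  choose k g hg h using fun i => (hf i).2
  refine isZMapOn_of_finite (continuousOn_pi.2 hc) (fun (s : ∀ i, Fin (k i)) x i => g i (s i) x)
    (fun s => isIntAffine_of_apply fun i => hg i (s i)) fun x hx => ?_
  choose s hs using fun i => h i x hx
  exact ⟨s, funext hs⟩

theorem IsZMapOn.mono {n m : ℕ} {P R : Set (Fin n → ℝ)} {f : (Fin n → ℝ) → (Fin m → ℝ)}
    (hf : IsZMapOn P f) (h : R ⊆ P) : IsZMapOn R f :=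
  ⟨hf.1.mono h, hf.2.imp fun _ ⟨g, hg, H⟩ => ⟨g, hg, fun x hx => H x (h hx)⟩⟩

theorem IsZMapOn.congr {n m : ℕ} {P : Set (Fin n → ℝ)} {f f' : (Fin n → ℝ) → (Fin m → ℝ)}
    (hf : IsZMapOn P f) (h : EqOn f' f P) : IsZMapOn P f' :=
  ⟨hf.1.congr h, hf.2.imp fun _ ⟨g, hg, H⟩ => ⟨g, hg, fun x hx => by rw [h hx]; exact H x hx⟩⟩

theorem isZMapOn_id {n : ℕ} (P : Set (Fin n → ℝ)) : IsZMapOn P id :=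
  ⟨continuousOn_id, 1, fun _ => id, fun _ => isIntAffine_of_apply fun i =>
    ⟨Pi.single i 1, 0, fun x => by simp [Pi.single_apply]⟩, fun _ _ => ⟨0, rfl⟩⟩

theorem IsZMapOn.comp {n m l : ℕ} {P : Set (Fin n → ℝ)} {R : Set (Fin m → ℝ)}
    {f : (Fin n → ℝ) → (Fin m → ℝ)} {g : (Fin m → ℝ) → (Fin l → ℝ)} (hg : IsZMapOn R g)
    (hf : IsZMapOn P f) (h : MapsTo f P R) : IsZMapOn P (g ∘ f) := by
  obtain ⟨hfc, k, a, ha, hfa⟩ := hf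
  obtain ⟨hgc, l, b, hb, hgb⟩ := hg
  refine isZMapOn_of_finite (hgc.comp hfc h) (fun (p : Fin l × Fin k) => b p.1 ∘ a p.2)
    (fun p => (hb _).comp (ha _)) fun x hx => ?_
  obtain ⟨i, hi⟩ := hfa x hx
  obtain ⟨j, hj⟩ := hgb _ (h hx)
  exact ⟨(j, i), hj.trans (congrArg (b j) hi)⟩

/-- A Z-map from a rational polyhedron to the unit cube extends to the whole space. -/
theorem IsZMapOn.exists_extension {n m : ℕ} {Q : Set (Fin n → ℝ)} (hQ : IsRationalPolyhedron Q)
    {f : (Fin n → ℝ) → (Fin m → ℝ)} (hf : IsZMapOn Q f) (hQf : MapsTo f Q (cubeSet m)) :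
    ∃ F, IsZMapOn univ F ∧ (∀ x, F x ∈ cubeSet m) ∧ EqOn F f Q := by
  choose F hF hFf using fun i => (hf.apply i).exists_extension hQ
  refine ⟨fun x i => ((fun _ => ((0 : ℤ) : ℝ)) ⊔ (F i ⊓ fun _ => ((1 : ℤ) : ℝ))) x,
    isZMapOn_of_apply fun i => ((isIntAffine1_const 0).isZMapOn1 _).sup
      ((hF i).inf ((isIntAffine1_const 1).isZMapOn1 _)), fun x => ⟨fun i => ?_, fun i => ?_⟩,
    fun x hx => funext fun i => ?_⟩
  · simp
  · simp
  · have h0 : 0 ≤ f x i := (hQf hx).1 i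
    have h1 : f x i ≤ 1 := (hQf hx).2 i
    simp [hFf i hx, h0, h1]

/-- Z-maps on pairwise disjoint rational polyhedra can be glued. -/
theorem exists_isZMapOn_iUnion {n l : ℕ} {κ : Type*} [Finite κ] {Q : κ → Set (Fin n → ℝ)}
    (hQ : ∀ j, IsRationalPolyhedron (Q j)) (hdisj : ∀ i j, i ≠ j → Disjoint (Q i) (Q j))
    {f : κ → (Fin n → ℝ) → (Fin l → ℝ)} (hf : ∀ j, IsZMapOn (Q j) (f j)) :
    ∃ F, IsZMapOn (⋃ j, Q j) F ∧ ∀ j, EqOn F (f j) (Q j) := by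
  classical
  let F : (Fin n → ℝ) → (Fin l → ℝ) := fun x => if h : ∃ j, x ∈ Q j then f h.choose x else 0
  have hF : ∀ j, EqOn F (f j) (Q j) := fun j x hx => by
    have h : ∃ j, x ∈ Q j := ⟨j, hx⟩
    have : h.choose = j := by
      by_contra hne
      exact disjoint_left.1 (hdisj _ _ hne) h.choose_spec hx
    simp only [F, dif_pos h, this]
  refine ⟨F, ?_, hF⟩
  have hc := fun j => (hf j).1
  choose k g hg h using fun j => (hf j).2
  refine isZMapOn_of_finite ((locallyFinite_of_finite Q).continuousOn_iUnion
    (fun j => (hQ j).isClosed) fun j => (hc j).congr (hF j))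
    (fun p : Σ j, Fin (k j) => g p.1 p.2) (fun p => hg _ _) fun x hx => ?_
  obtain ⟨j, hj⟩ := mem_iUnion.1 hx
  obtain ⟨i, hi⟩ := h j x hj
  exact ⟨⟨j, i⟩, (hF j hj).trans hi⟩

theorem IsRationalPolyhedron.iUnion {n : ℕ} {κ : Type*} [Fintype κ] {Q : κ → Set (Fin n → ℝ)}
    (hQ : ∀ j, IsRationalPolyhedron (Q j)) : IsRationalPolyhedron (⋃ j, Q j) := by
  classical
  choose S hS hQS using hQ
  refine ⟨Finset.univ.biUnion S, fun F hF => ?_, ?_⟩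
  · obtain ⟨j, -, hj⟩ := Finset.mem_biUnion.1 hF
    exact hS j F hj
  · ext x
    simp only [mem_iUnion, Finset.mem_biUnion, Finset.mem_univ, true_and, hQS, exists_prop]
    tauto

theorem IsZHomeoOnto.congr {n m : ℕ} {P : Set (Fin n → ℝ)} {R : Set (Fin m → ℝ)}
    {f f' : (Fin n → ℝ) → (Fin m → ℝ)} (hf : IsZHomeoOnto P R f) (h : EqOn f' f P) :
    IsZHomeoOnto P R f' := by
  obtain ⟨h1, h2, h3, g, hg, hgf, hfg⟩ := hf
  refine ⟨h1.congr h, h.image_eq.trans h2, h3.congr h.symm, g, hg,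
    fun x hx => by rw [h hx, hgf x hx], fun y hy => ?_⟩
  obtain ⟨x, hx, rfl⟩ : y ∈ f '' P := h2 ▸ hy
  rw [hgf x hx, h hx]

theorem isZHomeoOnto_id {n : ℕ} (P : Set (Fin n → ℝ)) : IsZHomeoOnto P P id :=
  ⟨isZMapOn_id P, image_id P, injOn_id P, id, isZMapOn_id P, fun _ _ => rfl, fun _ _ => rfl⟩

/-- If the range of `σ` is a closed domain then the inverse of `σ` on a Z-homeomorphism
domain is, at every point, one of the inverses of the invertible affine pieces of `σ`. -/
theorem IsZHomeoDomain.exists_inverse {n k : ℕ} {σ : (Fin n → ℝ) → (Fin n → ℝ)}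
    {R : Set (Fin n → ℝ)} (hR : IsZHomeoDomain σ R) (hcl : IsClosedDomain (zRange σ))
    {g : Fin k → (Fin n → ℝ) → (Fin n → ℝ)} (hg : ∀ i, IsIntAffine (g i))
    (hσg : ∀ x ∈ cubeSet n, ∃ i, σ x = g i x) :
    ∃ τ, ContinuousOn τ (zRange σ) ∧ τ '' zRange σ = R ∧
      ∀ x ∈ zRange σ, ∃ i, ∃ h, IsIntAffine h ∧ (∀ y, g i (h y) = y) ∧ g i (τ x) = x := by
  obtain ⟨-, hRcube, -, hRσ, -, τ, ⟨hτc, l, t, ht, hτt⟩, hτσ, hστ⟩ := hR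
  have hτR : ∀ y ∈ zRange σ, τ y ∈ R := fun y hy => by
    obtain ⟨x, hx, rfl⟩ : y ∈ σ '' R := hRσ ▸ hy
    rwa [hτσ x hx]
  refine ⟨τ, hτc, Subset.antisymm (image_subset_iff.2 hτR) fun x hx =>
    ⟨σ x, hRσ ▸ mem_image_of_mem σ hx, hτσ x hx⟩, ?_⟩
  let A : Fin k × Fin l → Set (Fin n → ℝ) := fun p => {x | g p.1 (t p.2 x) = x}
  have hA : ∀ p, IsClosed (A p) := fun p =>
    isClosed_eq ((hg p.1).continuous.comp (ht p.2).continuous) continuous_id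
  have hAd : ∀ p, A p = univ ∨ Dense (A p)ᶜ := fun p => by
    rw [← interior_eq_empty_iff_dense_compl]
    rcases (interior (A p)).eq_empty_or_nonempty with h | h
    · exact Or.inr h
    · refine Or.inl (eq_univ_of_forall ?_)
      obtain ⟨G, hG⟩ := ((hg p.1).comp (ht p.2)).exists_affineMap
      have : G = AffineMap.id ℝ _ := by
        refine AffineMap.ext_on (isOpen_interior.affineSpan_eq_top h) fun x hx => ?_
        have : x ∈ A p := interior_subset hx
        rw [hG]
        exact this
      intro x
      have := DFunLike.congr_fun this x
      rwa [hG] at this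
  let W : Set (Fin n → ℝ) := ⋂ p : {p // Dense (A p)ᶜ}, (A p.1)ᶜ
  have hW : Dense W := dense_iInter_of_isOpen (fun p => (hA p.1).isOpen_compl) fun p => p.2
  let J : Set (Fin k) := {i | ∃ h, IsIntAffine h ∧ ∀ y, g i (h y) = y}
  let Z : Set (Fin n → ℝ) := ⋃ i ∈ J, zRange σ ∩ (fun x => g i (τ x) - x) ⁻¹' {0}
  have hZ : IsClosed Z := (Set.toFinite J).isClosed_biUnion fun i _ =>
    (((hg i).continuous.comp_continuousOn hτc).sub continuousOn_id).preimage_isClosed_of_isClosed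
      (by rw [← hcl]; exact isClosed_closure) isClosed_singleton
  have hWZ : interior (zRange σ) ∩ W ⊆ Z := by
    rintro x ⟨hx, hxW⟩
    have hx : x ∈ zRange σ := interior_subset hx
    obtain ⟨j, hj⟩ := hτt x hx
    obtain ⟨i, hi⟩ := hσg _ (hRcube (hτR x hx))
    rw [hστ x hx] at hi
    have hxA : x ∈ A (i, j) := by
      show g i (t j x) = x
      rw [← hj, ← hi]
    have hAu : A (i, j) = univ := (hAd (i, j)).resolve_right fun h =>
      mem_iInter.1 hxW ⟨(i, j), h⟩ hxA
    refine mem_biUnion (show i ∈ J from ⟨t j, ht j, fun y => ?_⟩) ⟨hx, sub_eq_zero.2 hi.symm⟩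
    exact (hAu ▸ mem_univ y : y ∈ A (i, j))
  intro x hx
  have hxZ : x ∈ Z := by
    have h1 : zRange σ ⊆ closure (interior (zRange σ) ∩ W) := by
      conv_lhs => rw [← hcl]
      rw [inter_comm]
      refine closure_minimal ?_ isClosed_closure
      rw [inter_comm]
      exact hW.open_subset_closure_inter isOpen_interior
    exact closure_minimal hWZ hZ (h1 hx)
  obtain ⟨i, ⟨h, hh, hgh⟩, -, hi⟩ := mem_iUnion₂.1 hxZ
  exact ⟨i, h, hh, hgh, sub_eq_zero.1 hi⟩

theorem IsIntAffine.injective_of_surjective {n : ℕ} {g : (Fin n → ℝ) → (Fin n → ℝ)}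
    (hg : IsIntAffine g) (hs : Function.Surjective g) : Function.Injective g := by
  obtain ⟨G, rfl⟩ := hg.exists_affineMap
  rw [← G.linear_injective_iff]
  exact LinearMap.injective_iff_surjective.2 (G.linear_surjective_iff.2 hs)

/-- If the range of a Z-retraction is a rational polyhedron and a closed domain, then the
retraction has only finitely many Z-homeomorphism domains. -/
theorem finite_setOf_isZHomeoDomain {n : ℕ} {σ : (Fin n → ℝ) → (Fin n → ℝ)}
    (hσ : IsZMapOn (cubeSet n) σ) (hP : IsRationalPolyhedron (zRange σ))
    (hne : (zRange σ).Nonempty) (hcl : IsClosedDomain (zRange σ)) :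
    {R | IsZHomeoDomain σ R}.Finite := by
  classical
  obtain ⟨-, k, g, hg, hσg⟩ := hσ
  let J := {i : Fin k // ∃ h, IsIntAffine h ∧ ∀ y, g i (h y) = y}
  choose h hh hgh using fun i : J => i.2
  have hinj : ∀ i : J, Function.Injective (g i.1) := fun i =>
    (hg i.1).injective_of_surjective fun y => ⟨h i y, hgh i y⟩
  obtain ⟨ι, _, T, hT, hTP⟩ := hP.exists_iUnion
  let ℓ : J × J × Fin n → (Fin n → ℝ) → ℝ := fun p x => h p.1 x p.2.2 - h p.2.1 x p.2.2
  have hℓ : ∀ p, IsIntAffine1 (ℓ p) := fun p => ((hh _).apply _).sub ((hh _).apply _)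
  let C : ι × (J × J × Fin n → SignType) → Set (Fin n → ℝ) := fun a => T a.1 ∩ signCell ℓ a.2
  refine (Set.finite_range fun s : ι × (J × J × Fin n → SignType) → J =>
    ⋃ a, h (s a) '' C a).subset fun R hR => ?_
  obtain ⟨τ, hτc, rfl, hτ⟩ := IsZHomeoDomain.exists_inverse hR hcl hg hσg
  have hsel : ∀ x ∈ zRange σ, ∃ i : J, τ x = h i x := fun x hx => by
    obtain ⟨i, h', hh', hgh', hi⟩ := hτ x hx
    exact ⟨⟨i, h', hh', hgh'⟩, hinj ⟨i, h', hh', hgh'⟩ (hi.trans (hgh ⟨i, h', hh', hgh'⟩ x).symm)⟩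
  have : Nonempty J := ⟨(hsel _ hne.some_mem).choose⟩
  have hCP : ∀ a, C a ⊆ zRange σ := fun a x hx => hTP ▸ mem_iUnion.2 ⟨a.1, hx.1⟩
  have key : ∀ a, ∃ i, EqOn τ (h i) (C a) := fun a => by
    refine exists_eqOn_of_isPreconnected
      ((hT a.1).convex.inter (convex_signCell hℓ a.2)).isPreconnected (hτc.mono (hCP a))
      (fun i => (hh i).continuous.continuousOn) (fun x hx => hsel x (hCP a hx)) fun i j => ?_
    by_cases hij : ∀ c, ∀ x ∈ signCell ℓ a.2, ℓ (i, j, c) x = 0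
    · exact Or.inl fun x hx => funext fun c => sub_eq_zero.1 (hij c x hx.2)
    · obtain ⟨c, hc⟩ := not_forall.1 hij
      have := (eq_or_ne_on_signCell a.2 (i, j, c)).resolve_left hc
      exact Or.inr fun x hx he => this x hx.2 (sub_eq_zero.2 (congrFun he c))
  choose s hs using key
  refine ⟨s, ?_⟩
  have hPC : zRange σ = ⋃ a, C a := by
    refine Subset.antisymm (fun x hx => ?_) (iUnion_subset hCP)
    rw [hTP] at hx
    obtain ⟨i, hi⟩ := mem_iUnion.1 hx
    exact mem_iUnion.2 ⟨(i, fun p => SignType.sign (ℓ p x)), hi, fun p => rfl⟩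
  rw [hPC, image_iUnion]
  exact iUnion_congr fun a => (hs a).image_eq.symm

/-- If `P ⊆ [0,1]^n` is the range of some Z-retraction and is a closed domain,
and `Q 0 = P, Q 1, …, Q (m-1)` are pairwise disjoint rational polyhedra in the cube, each
Z-homeomorphic to `P`, then there is a Z-retraction `σ` with range `P` restricting to a
Z-homeomorphism of each `Q j` onto `P`; in particular `σ` has at least `m`
Z-homeomorphism domains. -/
theorem stmt5 {n : ℕ} (hn : 1 ≤ n) (P : Set (Fin n → ℝ))
    (hP : ∃ ρ, IsZRetraction ρ ∧ zRange ρ = P) (hcd : IsClosedDomain P)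
    (m : ℕ) (hm : 0 < m) (Q : Fin m → Set (Fin n → ℝ))
    (hQ0 : Q ⟨0, hm⟩ = P)
    (hpoly : ∀ j, IsRationalPolyhedron (Q j)) (hsub : ∀ j, Q j ⊆ cubeSet n)
    (hdisj : ∀ i j, i ≠ j → Disjoint (Q i) (Q j))
    (hhom : ∀ j, ∃ f, IsZHomeoOnto (Q j) P f) :
    ∃ σ, IsZRetraction σ ∧ zRange σ = P ∧
      (∀ j, IsZHomeoOnto (Q j) P σ) ∧ (∀ j, IsZHomeoDomain σ (Q j)) ∧
      m ≤ Nat.card {R : Set (Fin n → ℝ) // IsZHomeoDomain σ R} := by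
  classical
  obtain ⟨ρ, ⟨hρZ, hρmaps, hρid⟩, hρP⟩ := hP
  have hfix : ∀ x ∈ P, ρ x = x := fun x hx => by
    rw [← hρP] at hx
    obtain ⟨y, hy, rfl⟩ := hx
    exact hρid y hy
  have hPcube : P ⊆ cubeSet n := hQ0 ▸ hsub _
  have hPpoly : IsRationalPolyhedron P := hQ0 ▸ hpoly _
  have hPne : P.Nonempty := by
    rw [← hρP]
    exact (show (cubeSet n).Nonempty from ⟨0, le_rfl, zero_le_one⟩).image ρ
  have hhom' : ∀ j, ∃ f, IsZHomeoOnto (Q j) P f ∧ (j = ⟨0, hm⟩ → f = id) := fun j => by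
    by_cases hj : j = ⟨0, hm⟩
    · subst hj
      exact ⟨id, by rw [hQ0]; exact isZHomeoOnto_id P, fun _ => rfl⟩
    · obtain ⟨f, hf⟩ := hhom j
      exact ⟨f, hf, fun h => absurd h hj⟩
  choose f hf hf0 using hhom'
  have hfP : ∀ j, MapsTo (f j) (Q j) P := fun j x hx => (hf j).2.1 ▸ mem_image_of_mem _ hx
  obtain ⟨F₀, hF₀, hF₀f⟩ := exists_isZMapOn_iUnion hpoly hdisj fun j => (hf j).1
  obtain ⟨F, hF, hFcube, hFF₀⟩ := hF₀.exists_extension (.iUnion hpoly) fun x hx => by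
    obtain ⟨j, hj⟩ := mem_iUnion.1 hx
    rw [hF₀f j hj]
    exact hPcube (hfP j hj)
  have hσf : ∀ j, EqOn (ρ ∘ F) (f j) (Q j) := fun j x hx => by
    rw [Function.comp, hFF₀ (mem_iUnion.2 ⟨j, hx⟩), hF₀f j hx, hfix _ (hfP j hx)]
  have hσid : ∀ x ∈ P, (ρ ∘ F) x = x := fun x hx => by
    rw [hσf ⟨0, hm⟩ (hQ0 ▸ hx), hf0 _ rfl, id]
  have hσP : ∀ x, (ρ ∘ F) x ∈ P := fun x => hρP ▸ mem_image_of_mem ρ (hFcube x)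
  have hσZ : IsZMapOn (cubeSet n) (ρ ∘ F) :=
    hρZ.comp (hF.mono (subset_univ _)) fun x _ => hFcube x
  have hrange : zRange (ρ ∘ F) = P :=
    Subset.antisymm (image_subset_iff.2 fun x _ => hσP x) fun x hx => ⟨x, hPcube hx, hσid x hx⟩
  have hhomeo : ∀ j, IsZHomeoOnto (Q j) P (ρ ∘ F) := fun j => (hf j).congr (hσf j)
  have hdom : ∀ j, IsZHomeoDomain (ρ ∘ F) (Q j) := fun j =>
    ⟨hpoly j, hsub j, by rw [hrange]; exact hhomeo j⟩
  refine ⟨ρ ∘ F, ⟨hσZ, fun x _ => hPcube (hσP x), fun x _ => hσid _ (hσP x)⟩, hrange, hhomeo,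
    hdom, ?_⟩
  have hfin : Finite {R : Set (Fin n → ℝ) // IsZHomeoDomain (ρ ∘ F) R} :=
    (finite_setOf_isZHomeoDomain hσZ (hrange ▸ hPpoly) (hrange ▸ hPne) (hrange ▸ hcd)).to_subtype
  have hQne : ∀ j, (Q j).Nonempty := fun j => by
    rw [← image_nonempty, (hf j).2.1]
    exact hPne
  have hinj : Function.Injective fun j : Fin m =>
      (⟨Q j, hdom j⟩ : {R : Set (Fin n → ℝ) // IsZHomeoDomain (ρ ∘ F) R}) := fun i j hij => by
    by_contra hne
    have hij : Q i = Q j := congrArg Subtype.val hij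
    obtain ⟨x, hx⟩ := hQne i
    exact disjoint_left.1 (hdisj i j hne) hx (hij ▸ hx)
  simpa using Nat.card_le_card_of_injective _ hinj
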